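/- Let μ : [0,∞) → ℝ be continuous on [0,∞) and continuously differentiable on (0,∞) with μ(ρ) > 0 and μ'(ρ) > 0 for every ρ > 0, satisfying the large-density condition with exponent β ∈ (1,4). Fix r > 0. Then there exist M > 0 and C > 0 such that for every ℤ³-periodic continuously differentiable function ρ : ℝ³ → (0,∞) with ∫_Q ρ dx = r, one has ∫_Q (μ'(ρ(x))/ρ(x)) |∇ρ(x)|² dx ≥ C ∫_Q ρ(x) ln ρ(x) · 𝟙_{ρ(x) ≥ M} dx. -/

import Mathlib

open MeasureTheory Filter

/-- Partial derivative in direction `i`. -/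
noncomputable def pd (i : Fin 3) (f : (Fin 3 → ℝ) → ℝ) (x : Fin 3 → ℝ) : ℝ :=
  fderiv ℝ f x (Pi.single i 1)

/-- Squared Euclidean norm of the gradient. -/
noncomputable def gradSq (f : (Fin 3 → ℝ) → ℝ) (x : Fin 3 → ℝ) : ℝ :=
  ∑ i, (pd i f x) ^ 2

/-- `ℤ³`-periodicity. -/
def ZPeriodic (f : (Fin 3 → ℝ) → ℝ) : Prop :=
  ∀ (x : Fin 3 → ℝ) (k : Fin 3 → ℤ), f (x + fun i => (k i : ℝ)) = f x

/-- The unit cell `Q = [0,1]³`. -/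
def Qcell : Set (Fin 3 → ℝ) := Set.Icc 0 1

noncomputable def nu1 : Measure ℝ := volume.restrict (Set.Icc 0 1)
noncomputable def PQ : Measure (Fin 3 → ℝ) := Measure.pi (fun _ => nu1)

instance : IsProbabilityMeasure nu1 := ⟨by simp [nu1]⟩
instance : IsProbabilityMeasure PQ := by unfold PQ; infer_instance

theorem PQ_eq : volume.restrict Qcell = PQ := by
  unfold PQ nu1 Qcell
  rw [← Measure.restrict_pi_pi, ← Set.pi_univ_Icc]
  rfl

theorem int_PQ {f : (Fin 3 → ℝ) → ℝ} (hf : Continuous f) : Integrable f PQ := by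
  rw [← PQ_eq]
  exact hf.continuousOn.integrableOn_compact isCompact_Icc

theorem int_PQ2 {f : (Fin 3 → ℝ) × (Fin 3 → ℝ) → ℝ} (hf : Continuous f) :
    Integrable f (PQ.prod PQ) := by
  rw [← PQ_eq, Measure.prod_restrict]
  exact hf.continuousOn.integrableOn_compact (isCompact_Icc.prod isCompact_Icc)

theorem int_nu1 {f : ℝ → ℝ} (hf : Continuous f) : Integrable f nu1 :=
  hf.continuousOn.integrableOn_compact isCompact_Icc

/-- Splice two points: coordinates in `S` from the second one. -/
def sp (S : Finset (Fin 3)) (p : (Fin 3 → ℝ) × (Fin 3 → ℝ)) : Fin 3 → ℝ :=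
  fun i => if i ∈ S then p.2 i else p.1 i

theorem sp_cont (S : Finset (Fin 3)) : Continuous (sp S) := by
  refine continuous_pi fun i => ?_
  unfold sp
  split_ifs <;> fun_prop

theorem sp_mp (S : Finset (Fin 3)) : MeasurePreserving (sp S) (PQ.prod PQ) PQ := by
  have h1 := (measurePreserving_arrowProdEquivProdArrow ℝ ℝ (Fin 3) (fun _ => nu1) (fun _ => nu1)).symm
  have h2 : MeasurePreserving (fun (a : Fin 3 → ℝ × ℝ) i => if i ∈ S then (a i).2 else (a i).1)
      (Measure.pi (fun _ => nu1.prod nu1)) PQ := by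
    refine measurePreserving_pi (fun _ : Fin 3 => nu1.prod nu1) (fun _ => nu1)
      (f := fun i a => if i ∈ S then a.2 else a.1) fun i => ?_
    by_cases hi : i ∈ S
    · simpa [hi] using (measurePreserving_snd (μ := nu1) (ν := nu1))
    · simpa [hi] using (measurePreserving_fst (μ := nu1) (ν := nu1))
  exact h2.comp h1

theorem int_comp_sp (S : Finset (Fin 3)) {f : (Fin 3 → ℝ) → ℝ} (hf : Integrable f PQ) :
    ∫ p, f (sp S p) ∂(PQ.prod PQ) = ∫ x, f x ∂PQ := by
  have h := sp_mp S
  conv_rhs => rw [← h.map_eq]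
  rw [integral_map h.aemeasurable]
  rw [h.map_eq]; exact hf.aestronglyMeasurable

noncomputable def lineInt (i : Fin 3) (f : (Fin 3 → ℝ) → ℝ) (x : Fin 3 → ℝ) : ℝ :=
  ∫ t, f (Function.update x i t) ∂nu1

theorem lineInt_eq (i : Fin 3) {f : (Fin 3 → ℝ) → ℝ} (hf : Continuous f) (x : Fin 3 → ℝ) :
    lineInt i f x = ∫ y, f (sp {i} (x, y)) ∂PQ := by
  have h := measurePreserving_eval (fun _ : Fin 3 => nu1) i
  unfold lineInt
  conv_lhs => rw [← h.map_eq]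
  rw [integral_map h.aemeasurable]
  · refine integral_congr_ae (Eventually.of_forall fun y => ?_)
    simp only
    congr 1
    ext j
    by_cases hj : j = i
    · subst hj; simp [sp]
    · simp [sp, hj]
  · refine Continuous.aestronglyMeasurable ?_
    exact hf.comp (continuous_const.update i continuous_id)

theorem lineInt_int (i : Fin 3) {f : (Fin 3 → ℝ) → ℝ} (hf : Continuous f) :
    Integrable (lineInt i f) PQ := by
  rw [funext (lineInt_eq i hf)]
  exact (int_PQ2 (hf.comp (sp_cont {i}))).integral_prod_left

theorem lineInt_integral (i : Fin 3) {f : (Fin 3 → ℝ) → ℝ} (hf : Continuous f) :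
    ∫ x, lineInt i f x ∂PQ = ∫ x, f x ∂PQ := by
  rw [funext (lineInt_eq i hf), ← int_comp_sp {i} (int_PQ hf)]
  exact (integral_prod _ (int_PQ2 (hf.comp (sp_cont {i})))).symm

theorem oneD {h h' : ℝ → ℝ} (hd : ∀ t, HasDerivAt h (h' t) t) (hc : Continuous h')
    {a b : ℝ} (ha : a ∈ Set.Icc (0:ℝ) 1) (hb : b ∈ Set.Icc (0:ℝ) 1) :
    (h a - h b) ^ 2 ≤ ∫ t, (h' t) ^ 2 ∂nu1 := by
  have key : |h a - h b| ≤ ∫ t, |h' t| ∂nu1 := by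
    rw [← intervalIntegral.integral_eq_sub_of_hasDerivAt (fun t _ => hd t)
      (hc.intervalIntegrable b a)]
    have hn := intervalIntegral.norm_integral_le_integral_norm_uIoc (f := h') (a := b) (b := a)
      (μ := volume)
    refine hn.trans ?_
    refine setIntegral_mono_set (int_nu1 hc.abs) (Eventually.of_forall fun _ => abs_nonneg _) ?_
    refine LE.le.eventuallyLE ?_
    exact Set.uIoc_subset_uIcc.trans (Set.uIcc_subset_Icc hb ha)
  set m := ∫ t, |h' t| ∂nu1
  have hm : 2 * m * m ≤ ∫ t, ((h' t)^2 + m^2) ∂nu1 := by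
    rw [← integral_const_mul]
    refine integral_mono ((int_nu1 hc.abs).const_mul _) (int_nu1 (by fun_prop)) fun t => ?_
    have := sq_abs (h' t)
    simp only
    nlinarith [sq_nonneg (|h' t| - m)]
  rw [integral_add (int_nu1 (by fun_prop)) (int_nu1 (by fun_prop))] at hm
  simp at hm
  have := sq_abs (h a - h b)
  nlinarith [abs_nonneg (h a - h b)]

theorem pd_cont {g : (Fin 3 → ℝ) → ℝ} (hg : ContDiff ℝ 1 g) (i : Fin 3) : Continuous (pd i g) :=
  (hg.continuous_fderiv one_ne_zero).clm_apply continuous_const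

theorem step {g : (Fin 3 → ℝ) → ℝ} (hg : ContDiff ℝ 1 g) (i : Fin 3) (z w : Fin 3 → ℝ)
    (hz : z i ∈ Set.Icc (0:ℝ) 1) (hw : w i ∈ Set.Icc (0:ℝ) 1) (h : ∀ j, j ≠ i → w j = z j) :
    (g z - g w) ^ 2 ≤ lineInt i (fun x => pd i g x ^ 2) z := by
  have h1 : w = Function.update z i (w i) := by
    ext j
    by_cases hj : j = i
    · subst hj; simp
    · simp [hj, h j hj]
  have := oneD (h := fun t => g (Function.update z i t))
    (h' := fun t => pd i g (Function.update z i t)) (fun t => by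
      have h2 := (hg.differentiable one_ne_zero (Function.update z i t)).hasFDerivAt
      exact h2.comp_hasDerivAt t (hasDerivAt_update z i t))
    ((pd_cont hg i).comp (continuous_const.update i continuous_id)) hz hw
  rw [← h1] at this
  simpa [lineInt] using this

theorem poincare {g : (Fin 3 → ℝ) → ℝ} (hg : ContDiff ℝ 1 g) :
    2 * (∫ x, g x ^ 2 ∂PQ) - 2 * (∫ x, g x ∂PQ) ^ 2 ≤ 3 * ∫ x, gradSq g x ∂PQ := by
  have gc := hg.continuous
  have hpc : ∀ i, Continuous (fun x => pd i g x ^ 2) := fun i => (pd_cont hg i).pow 2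
  let L : Fin 3 → (Fin 3 → ℝ) → ℝ := fun i => lineInt i (fun x => pd i g x ^ 2)
  have hLint : ∀ i, Integrable (L i) PQ := fun i => lineInt_int i (hpc i)
  have hLsp : ∀ i S, Integrable (fun p => L i (sp S p)) (PQ.prod PQ) := fun i S =>
    (sp_mp S).integrable_comp_of_integrable (hLint i)
  have hLI : ∀ i S, ∫ p, L i (sp S p) ∂(PQ.prod PQ) = ∫ x, pd i g x ^ 2 ∂PQ := fun i S => by
    rw [int_comp_sp S (hLint i)]; exact lineInt_integral i (hpc i)
  have hle : ∫ p, (g p.1 - g p.2) ^ 2 ∂(PQ.prod PQ) ≤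
      ∫ p, 3 * (L 0 (sp ∅ p) + L 1 (sp {0} p) + L 2 (sp {0,1} p)) ∂(PQ.prod PQ) := by
    refine integral_mono_ae (int_PQ2 (by fun_prop))
      ((((hLsp 0 ∅).add (hLsp 1 {0})).add (hLsp 2 {0,1})).const_mul 3) ?_
    have hae : ∀ᵐ p ∂(PQ.prod PQ), p ∈ Qcell ×ˢ Qcell := by
      rw [← PQ_eq, Measure.prod_restrict]
      exact ae_restrict_mem (measurableSet_Icc.prod measurableSet_Icc)
    filter_upwards [hae] with p hp
    have hx : ∀ i, p.1 i ∈ Set.Icc (0:ℝ) 1 := fun i => ⟨hp.1.1 i, hp.1.2 i⟩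
    have hy : ∀ i, p.2 i ∈ Set.Icc (0:ℝ) 1 := fun i => ⟨hp.2.1 i, hp.2.2 i⟩
    have s0 := step hg 0 (sp ∅ p) (sp {0} p) (by simpa [sp] using hx 0) (by simpa [sp] using hy 0)
      (by intro j hj; simp [sp, hj])
    have s1 := step hg 1 (sp {0} p) (sp {0,1} p) (by simpa [sp] using hx 1)
      (by simpa [sp] using hy 1) (by intro j hj; simp [sp, hj])
    have s2 := step hg 2 (sp {0,1} p) p.2 (by simpa [sp] using hx 2)
      (hy 2) (by intro j hj; fin_cases j <;> simp [sp] at hj ⊢)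
    have e0 : sp ∅ p = p.1 := by ext j; simp [sp]
    simp only [e0] at s0 ⊢
    change _ ≤ L 0 _ at s0
    change _ ≤ L 1 _ at s1
    change _ ≤ L 2 _ at s2
    set A := g p.1
    set B := g (sp {0} p)
    set C := g (sp {0,1} p)
    set D := g p.2
    nlinarith [sq_nonneg ((A-B)-(B-C)), sq_nonneg ((A-B)-(C-D)), sq_nonneg ((B-C)-(C-D))]
  have h01 : Integrable (fun p => L 0 (sp ∅ p) + L 1 (sp {0} p)) (PQ.prod PQ) :=
    (hLsp 0 ∅).add (hLsp 1 {0})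
  rw [integral_const_mul, integral_add h01 (hLsp 2 {0,1}),
    integral_add (hLsp 0 ∅) (hLsp 1 {0}), hLI, hLI, hLI] at hle
  have hgs : ∫ x, gradSq g x ∂PQ =
      ∫ x, pd 0 g x ^ 2 ∂PQ + ∫ x, pd 1 g x ^ 2 ∂PQ + ∫ x, pd 2 g x ^ 2 ∂PQ := by
    unfold gradSq
    rw [integral_finsetSum _ (fun i _ => int_PQ (hpc i)), Fin.sum_univ_three]
  have hlhs : ∫ p, (g p.1 - g p.2) ^ 2 ∂(PQ.prod PQ) =
      2 * (∫ x, g x ^ 2 ∂PQ) - 2 * (∫ x, g x ∂PQ) ^ 2 := by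
    have e : ∀ p : (Fin 3 → ℝ) × (Fin 3 → ℝ), (g p.1 - g p.2) ^ 2
      = (g p.1 ^ 2 * 1 + 1 * g p.2 ^ 2) - 2 * (g p.1 * g p.2) := fun p => by ring
    simp_rw [e]
    rw [integral_sub (int_PQ2 (by fun_prop)) (int_PQ2 (by fun_prop)),
      integral_add (int_PQ2 (by fun_prop)) (int_PQ2 (by fun_prop)),
      integral_const_mul 2, integral_prod_mul (fun x => g x ^ 2) (fun _ => (1:ℝ)),
      integral_prod_mul (fun _ => (1:ℝ)) (fun x => g x ^ 2), integral_prod_mul]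
    simp
    ring
  rw [← hlhs, hgs]
  exact hle

theorem sqpos_deriv (y : ℝ) : HasDerivAt (fun y : ℝ => max y 0 ^ 2) (2 * max y 0) y := by
  have hne : ∀ y : ℝ, y ≠ 0 → HasDerivAt (fun y : ℝ => max y 0 ^ 2) (2 * max y 0) y := by
    intro y hy
    rcases lt_or_gt_of_ne hy with h | h
    · rw [max_eq_right h.le, mul_zero]
      refine (hasDerivAt_const y (0:ℝ)).congr_of_eventuallyEq ?_
      filter_upwards [Iio_mem_nhds h] with z hz
      simp [max_eq_right (le_of_lt (Set.mem_Iio.1 hz))]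
    · rw [max_eq_left h.le]
      have := hasDerivAt_pow 2 y
      refine (HasDerivAt.congr_of_eventuallyEq (by simpa using this) ?_ : HasDerivAt _ (2 * y) y)
      filter_upwards [Ioi_mem_nhds h] with z hz
      simp [max_eq_left (le_of_lt (Set.mem_Ioi.1 hz))]
  by_cases hy : y = 0
  · subst hy
    exact hasDerivAt_of_hasDerivAt_of_ne hne (by fun_prop) (by fun_prop)
  · exact hne y hy

theorem sqpos_contDiff : ContDiff ℝ 1 (fun y : ℝ => max y 0 ^ 2) := by
  rw [contDiff_one_iff_deriv]
  refine ⟨fun y => (sqpos_deriv y).differentiableAt, ?_⟩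
  rw [funext fun y => (sqpos_deriv y).deriv]
  fun_prop

theorem Phi_deriv {μ : ℝ → ℝ} {s d : ℝ} (K : ℝ) (hK : 0 ≤ K) (hd : HasDerivAt μ d s) (hs : 0 < μ s) :
    ∃ e, HasDerivAt (fun s => max (√(μ s) - K) 0 ^ 2 / √(μ s)) e s ∧ e ^ 2 ≤ d ^ 2 / (4 * μ s) ∧
      (√(μ s) ≤ K → e = 0) := by
  have h1 := hd.sqrt hs.ne'
  have hy : 0 < √(μ s) := Real.sqrt_pos.2 hs
  have h2 := (sqpos_deriv (√(μ s) - K)).comp s (h1.sub_const K)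
  have h3 := h2.div h1 hy.ne'
  refine ⟨_, h3, ?_, ?_⟩
  · have hm0 : 0 ≤ max (√(μ s) - K) 0 := le_max_right _ _
    have hm1 : max (√(μ s) - K) 0 ≤ √(μ s) := max_le (by linarith) hy.le
    have hsq : √(μ s) ^ 2 = μ s := Real.sq_sqrt hs.le
    simp only [Function.comp]
    rw [← hsq]
    rw [Real.sqrt_sq hy.le]
    generalize √(μ s) = y at *
    generalize max (y - K) 0 = m at *
    have e1 : ((2 * m * (d / (2 * y)) * y - m ^ 2 * (d / (2 * y))) / y ^ 2) ^ 2
      = (m * (2 * y - m) / y ^ 2) ^ 2 * (d ^ 2 / (4 * y ^ 2)) := by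
      field_simp
      ring
    rw [e1]
    have h4 : m * (2 * y - m) / y ^ 2 ≤ 1 := by
      rw [div_le_one (by positivity)]
      nlinarith [sq_nonneg (y - m)]
    have h5 : 0 ≤ m * (2 * y - m) / y ^ 2 :=
      div_nonneg (mul_nonneg hm0 (by linarith)) (by positivity)
    have h6 : (m * (2 * y - m) / y ^ 2) ^ 2 ≤ 1 := pow_le_one₀ h5 h4
    exact mul_le_of_le_one_left (by positivity) h6
  · intro h
    simp only [Function.comp]
    rw [max_eq_right (by linarith)]
    simp

theorem growth {μ : ℝ → ℝ} (hdiff : ∀ s > (0:ℝ), HasDerivAt μ (deriv μ s) s)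
    (hpos : ∀ ρ > (0:ℝ), 0 < μ ρ) {p s0 : ℝ} (hs0 : 1 ≤ s0)
    (h : ∀ s ≥ s0, p ≤ s * deriv μ s / μ s) :
    ∃ c > 0, ∀ s ≥ s0, c * s ^ p ≤ μ s := by
  have hd : ∀ s > (0:ℝ), HasDerivAt (fun s => Real.log (μ s) - p * Real.log s)
      (deriv μ s / μ s - p * s⁻¹) s := fun s hs =>
    ((hdiff s hs).log (hpos s hs).ne').sub ((Real.hasDerivAt_log hs.ne').const_mul p)
  have hmono : MonotoneOn (fun s => Real.log (μ s) - p * Real.log s) (Set.Ici s0) := by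
    refine monotoneOn_of_deriv_nonneg (convex_Ici s0) ?_ ?_ ?_
    · intro s hs
      exact (hd s (by have : s0 ≤ s := hs; linarith)).continuousAt.continuousWithinAt
    · intro s hs
      rw [interior_Ici] at hs
      exact (hd s (by have : s0 < s := hs; linarith)).differentiableAt.differentiableWithinAt
    · intro s hs
      rw [interior_Ici] at hs
      have hs' : s0 < s := hs
      have hsp : 0 < s := by linarith
      rw [(hd s hsp).deriv]
      have h1 := h s hs'.le
      have h2 : deriv μ s / μ s - p * s⁻¹ = (s * deriv μ s / μ s - p) / s := by
        field_simp
      rw [h2]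
      exact div_nonneg (by linarith) hsp.le
  refine ⟨Real.exp (Real.log (μ s0) - p * Real.log s0), Real.exp_pos _, fun s hs => ?_⟩
  have h1 := hmono (Set.mem_Ici.2 le_rfl) (Set.mem_Ici.2 hs) hs
  simp only at h1
  have hsp : 0 < s := by linarith
  rw [Real.rpow_def_of_pos hsp, ← Real.exp_add, ← Real.le_log_iff_exp_le (hpos s hsp)]
  linarith

theorem stmt2 (μ : ℝ → ℝ)
    (hcont : ContinuousOn μ (Set.Ici 0))
    (hC1 : ContDiffOn ℝ 1 μ (Set.Ioi 0))
    (hpos : ∀ ρ > (0:ℝ), 0 < μ ρ) (hpos' : ∀ ρ > (0:ℝ), 0 < deriv μ ρ)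
    (β : ℝ) (hβ1 : 1 < β) (hβ2 : β < 4)
    (hld : Tendsto (fun ρ => ρ * deriv μ ρ / μ ρ) atTop (nhds β))
    (r : ℝ) (hr : 0 < r) :
    ∃ M > (0:ℝ), ∃ C > (0:ℝ), ∀ ρ : (Fin 3 → ℝ) → ℝ,
      ContDiff ℝ 1 ρ → ZPeriodic ρ → (∀ x, 0 < ρ x) →
      (∫ x in Qcell, ρ x) = r →
      ∫ x in Qcell, (deriv μ (ρ x) / ρ x) * gradSq ρ x ≥
        C * ∫ x in Qcell, (if M ≤ ρ x then ρ x * Real.log (ρ x) else 0) := by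
  have hdiff : ∀ s > (0:ℝ), HasDerivAt μ (deriv μ s) s := fun s hs =>
    ((hC1.differentiableOn one_ne_zero).differentiableAt (Ioi_mem_nhds hs)).hasDerivAt
  have hdc : ContinuousOn (deriv μ) (Set.Ioi 0) :=
    hC1.continuousOn_deriv_of_isOpen isOpen_Ioi le_rfl
  have hmono : StrictMonoOn μ (Set.Ioi 0) := by
    refine strictMonoOn_of_deriv_pos (convex_Ioi 0) hC1.continuousOn ?_
    intro x hx
    rw [interior_Ioi] at hx
    exact hpos' x hx
  set p := (1 + β) / 2 with hp
  have hp1 : 1 < p := by rw [hp]; linarith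
  have hpβ : p < β := by rw [hp]; linarith
  have hev : ∀ᶠ s in atTop, 1 ≤ s ∧ p ≤ s * deriv μ s / μ s ∧ s * deriv μ s / μ s ≤ β + 1 := by
    filter_upwards [eventually_ge_atTop 1, hld.eventually (eventually_ge_nhds hpβ),
      hld.eventually (eventually_le_nhds (lt_add_one β))] with s h1 h2 h3
    exact ⟨h1, h2, h3⟩
  obtain ⟨s0, hs0⟩ := eventually_atTop.1 hev
  have hs01 := (hs0 s0 le_rfl).1
  obtain ⟨c, hc, hgr⟩ := growth hdiff hpos hs01 (fun s hs => (hs0 s hs).2.1)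
  set R := max s0 (2 * r) with hR
  have hRs0 : s0 ≤ R := le_max_left _ _
  have hRr : 2 * r ≤ R := le_max_right _ _
  have hR0 : 0 < R := by linarith
  set K := √(μ R) with hKdef
  have hK : 0 ≤ K := Real.sqrt_nonneg _
  have htop : Tendsto μ atTop atTop := by
    refine tendsto_atTop_mono' _ ?_ ((tendsto_rpow_atTop (by linarith : 0 < p)).const_mul_atTop hc)
    filter_upwards [eventually_ge_atTop s0] with s hs using hgr s hs
  obtain ⟨M0, hM0⟩ := eventually_atTop.1 (htop.eventually_ge_atTop ((2 * K) ^ 2))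
  set M := max M0 R with hM
  have hMR : R ≤ M := le_max_right _ _
  refine ⟨M, by linarith, c * (p - 1) / (12 * (β + 1)), ?_, ?_⟩
  · have : 0 < p - 1 := by linarith
    positivity
  intro ρ hρ _ hρpos hint
  rw [PQ_eq] at hint ⊢
  have hρc := hρ.continuous
  let g : (Fin 3 → ℝ) → ℝ := fun x => max (√(μ (ρ x)) - K) 0 ^ 2 / √(μ (ρ x))
  have hh : ContDiff ℝ 1 (fun x => √(μ (ρ x))) :=
    (hC1.comp_contDiff hρ (fun x => hρpos x)).sqrt (fun x => (hpos _ (hρpos x)).ne')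
  have hg : ContDiff ℝ 1 g := by
    refine ContDiff.div (sqpos_contDiff.comp (hh.sub contDiff_const)) hh fun x => ?_
    exact (Real.sqrt_pos.2 (hpos _ (hρpos x))).ne'
  have hgc := hg.continuous
  have hgz : ∀ x, ρ x ≤ R → √(μ (ρ x)) ≤ K := fun x hx =>
    Real.sqrt_le_sqrt (hmono.monotoneOn (hρpos x) hR0 hx)
  -- gradient bound
  have hgrad : ∀ x, gradSq g x ≤ (β + 1) / 4 * ((deriv μ (ρ x) / ρ x) * gradSq ρ x) := by
    intro x
    obtain ⟨e, he, he1, he2⟩ := Phi_deriv K hK (hdiff (ρ x) (hρpos x)) (hpos _ (hρpos x))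
    have hfd : HasFDerivAt g (e • fderiv ℝ ρ x) x :=
      he.comp_hasFDerivAt x (hρ.differentiable one_ne_zero x).hasFDerivAt
    have hpd : ∀ i, pd i g x = e * pd i ρ x := fun i => by
      unfold pd; rw [hfd.fderiv]; simp
    have hgs : gradSq g x = e ^ 2 * gradSq ρ x := by
      unfold gradSq; simp_rw [hpd, mul_pow, Finset.mul_sum]
    have hnn : 0 ≤ gradSq ρ x := Finset.sum_nonneg fun i _ => sq_nonneg _
    rw [hgs, ← mul_assoc]
    refine mul_le_mul_of_nonneg_right ?_ hnn
    have hdp := hpos' _ (hρpos x)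
    have hmp := hpos _ (hρpos x)
    have hrp := hρpos x
    by_cases hx : ρ x ≤ R
    · rw [he2 (hgz x hx)]
      simp only [ne_eq, OfNat.ofNat_ne_zero, not_false_eq_true, zero_pow]
      positivity
    · have h3 := (hs0 (ρ x) (by linarith)).2.2
      refine he1.trans ?_
      have e2 : deriv μ (ρ x) ^ 2 / (4 * μ (ρ x)) =
        (ρ x * deriv μ (ρ x) / μ (ρ x)) / 4 * (deriv μ (ρ x) / ρ x) := by field_simp
      rw [e2]
      gcongr
  have hgrc : ∀ f : (Fin 3 → ℝ) → ℝ, ContDiff ℝ 1 f → Continuous (gradSq f) := fun f hf =>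
    continuous_finsetSum _ fun i _ => (pd_cont hf i).pow 2
  have hI : Continuous fun x => (deriv μ (ρ x) / ρ x) * gradSq ρ x :=
    ((hdc.comp_continuous hρc hρpos).div hρc fun x => (hρpos x).ne').mul (hgrc ρ hρ)
  have hG : ∫ x, gradSq g x ∂PQ ≤
      (β + 1) / 4 * ∫ x, (deriv μ (ρ x) / ρ x) * gradSq ρ x ∂PQ := by
    rw [← integral_const_mul]
    exact integral_mono (int_PQ (hgrc g hg)) ((int_PQ hI).const_mul _) hgrad
  -- mean bound
  have hP := poincare hg
  set m := ∫ x, g x ∂PQ with hm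
  have hmean0 : ∀ t : ℝ, 2 * t * m ≤ (∫ x, g x ^ 2 ∂PQ) + t ^ 2 / R * r := by
    intro t
    have hi1 : Integrable (fun x => g x ^ 2) PQ := int_PQ (hgc.pow 2)
    have hi2 : Integrable (fun x => t ^ 2 / R * ρ x) PQ := int_PQ (continuous_const.mul hρc)
    rw [← hint, hm, ← integral_const_mul, ← integral_const_mul, ← integral_add hi1 hi2]
    refine integral_mono (int_PQ (continuous_const.mul hgc)) (hi1.add hi2) fun x => ?_
    simp only [Pi.add_apply]
    have hrp := hρpos x
    by_cases hx : ρ x ≤ R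
    · have : g x = 0 := by
        simp only [g]
        rw [max_eq_right (by linarith [hgz x hx])]; simp
      rw [this]
      simp only [mul_zero]
      positivity
    · have h1 : t ^ 2 ≤ t ^ 2 / R * ρ x := by
        rw [div_mul_eq_mul_div, le_div_iff₀ hR0]
        exact mul_le_mul_of_nonneg_left (by linarith) (sq_nonneg _)
      nlinarith [sq_nonneg (g x - t)]
  have hmean := hmean0 (2 * m)
  have hmean2 : (2 * m) ^ 2 / R * r ≤ 2 * m ^ 2 := by
    rw [div_mul_eq_mul_div, div_le_iff₀ hR0]
    nlinarith [sq_nonneg m]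
  have hg2 : ∫ x, g x ^ 2 ∂PQ ≤ 3 * ∫ x, gradSq g x ∂PQ := by nlinarith
  -- entropy bound
  have hent : c * (p - 1) / 16 * ∫ x, (if M ≤ ρ x then ρ x * Real.log (ρ x) else 0) ∂PQ
      ≤ ∫ x, g x ^ 2 ∂PQ := by
    rw [← integral_const_mul]
    have hp0 : 0 < p - 1 := by linarith
    refine integral_mono_of_nonneg (Eventually.of_forall fun x => ?_) (int_PQ (by fun_prop))
      (Eventually.of_forall fun x => ?_)
    · simp only [Pi.zero_apply]
      split_ifs with hx
      · have := Real.log_nonneg (by linarith : 1 ≤ ρ x)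
        have := hρpos x
        positivity
      · simp
    · simp only
      split_ifs with hx
      · have hrp := hρpos x
        have h1 := hgr (ρ x) (by linarith)
        have h2 := Real.log_le_rpow_div hrp.le hp0
        rw [le_div_iff₀ hp0] at h2
        have h3 : ρ x * (ρ x) ^ (p - 1) = ρ x ^ p := by
          rw [← Real.rpow_one_add' hrp.le (by linarith)]; congr 1; ring
        have h4 : (p - 1) * (ρ x * Real.log (ρ x)) ≤ ρ x ^ p := by
          rw [← h3]
          calc (p - 1) * (ρ x * Real.log (ρ x)) = ρ x * (Real.log (ρ x) * (p - 1)) := by ring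
            _ ≤ _ := mul_le_mul_of_nonneg_left h2 hrp.le
        have hmu := hM0 (ρ x) (le_trans (le_max_left _ _) hx)
        have hy2 : 2 * K ≤ √(μ (ρ x)) := Real.le_sqrt_of_sq_le hmu
        have hy : 0 < √(μ (ρ x)) := Real.sqrt_pos.2 (hpos _ hrp)
        have hgl : √(μ (ρ x)) / 4 ≤ g x := by
          simp only [g]
          rw [max_eq_left (by linarith), le_div_iff₀ hy]
          nlinarith
        have hsq := Real.sq_sqrt (hpos _ hrp).le
        have h5 : μ (ρ x) / 16 ≤ g x ^ 2 := by
          have h7 := pow_le_pow_left₀ (by positivity) hgl 2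
          rw [div_pow, hsq] at h7
          norm_num at h7 ⊢
          exact h7
        have h6 := mul_le_mul_of_nonneg_left h4 hc.le
        calc c * (p - 1) / 16 * (ρ x * Real.log (ρ x))
            = (c * ((p - 1) * (ρ x * Real.log (ρ x)))) / 16 := by ring
          _ ≤ μ (ρ x) / 16 := by gcongr; exact h6.trans h1
          _ ≤ g x ^ 2 := h5
      · rw [mul_zero]; positivity
  set E := ∫ x, (if M ≤ ρ x then ρ x * Real.log (ρ x) else 0) ∂PQ
  set D := ∫ x, (deriv μ (ρ x) / ρ x) * gradSq ρ x ∂PQ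
  have hfin : c * (p - 1) / 16 * E ≤ 3 * ((β + 1) / 4 * D) := by linarith
  have hb : 0 < 12 * (β + 1) := by linarith
  rw [ge_iff_le, div_mul_eq_mul_div, div_le_iff₀ hb]
  linarith
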